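/- Let σ be an integer greater than 2, ρ an integer relatively prime to σ, θ = 2ρπ/σ, and ω = e^{iθ}. Let G be a matrix over GF(2) with columns indexed by a finite set E, of rank r. For k = 0,1,…,σ−1, let 𝒯(k,σ) be the set of triples (f₁, f₂, f₃) of functions f_j : E → GF(2) such that f₁ − f₂ and f₂ − f₃ are flows of G and |supp(f₁)| + |supp(f₂)| + |supp(f₃)| ≡ k mod σ. Then Σ_{k=0}^{σ−1} ω^k |𝒯(k,σ)| = ω^{|E|−r} (1 + ω)^{|E|} (1 − ω)^{2r} R(M(G); 2/(cos θ − 1), 2(cos θ − 1)). -/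

import Mathlib

open Finset

/-- The vectors of the row space of `G` that vanish on `B` form a space whose dimension is the
corank of the columns indexed by `B`. -/
theorem finrank_rowSpace_vanishing_add {K ι : Type*} [Field K] {n : ℕ}
    (G : Fin n → ι → K) [Fintype ι] (B : Finset ι) :
    Module.finrank K (Submodule.span K ((fun e => fun i => G i e) '' (B : Set ι))) +
      Module.finrank K (LinearMap.ker ((LinearMap.funLeft K K (Subtype.val : B → ι)).domRestrict
        (Submodule.span K (Set.range G)))) =
      Module.finrank K (Submodule.span K (Set.range G)) := by
  rw [← LinearMap.finrank_range_add_finrank_ker ((LinearMap.funLeft K K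
    (Subtype.val : B → ι)).domRestrict (Submodule.span K (Set.range G)))]
  congr 1
  have h1 := Matrix.rank_transpose (R := K) (Matrix.of fun (i : Fin n) (e : B) => G i e)
  rw [Matrix.rank_eq_finrank_span_cols, Matrix.rank_eq_finrank_span_cols] at h1
  rw [LinearMap.range_domRestrict, Submodule.map_span, ← Set.range_comp,
    Set.image_eq_range]
  exact h1.symm

theorem finrank_column_span_univ {K ι : Type*} [Field K] [Fintype ι] {n : ℕ} (G : Fin n → ι → K) :
    Module.finrank K (Submodule.span K
      ((fun e => fun i => G i e) '' ((Finset.univ : Finset ι) : Set ι))) =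
      Module.finrank K (Submodule.span K (Set.range G)) := by
  have h := Matrix.rank_transpose (R := K) (Matrix.of G)
  rw [Matrix.rank_eq_finrank_span_cols, Matrix.rank_eq_finrank_span_cols] at h
  rw [Finset.coe_univ, Set.image_univ]
  exact h.symm

theorem card_rowSpace_vanishing {ι : Type*} [Fintype ι] [DecidableEq ι] {n : ℕ}
    (G : Fin n → ι → ZMod 2) (Flow : (ι → ZMod 2) → Prop) [DecidablePred Flow]
    (hFlow : ∀ h : ι → ZMod 2, Flow h ↔ h ∈ Submodule.span (ZMod 2) (Set.range G))
    (B : Finset ι) :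
    (Finset.univ.filter (fun u : ι → ZMod 2 => Flow u ∧ ∀ e ∈ B, u e = 0)).card =
      2 ^ (Module.finrank (ZMod 2) (Submodule.span (ZMod 2) (Set.range G)) -
        Module.finrank (ZMod 2)
          (Submodule.span (ZMod 2) ((fun e => fun i => G i e) '' (B : Set ι)))) := by
  rw [← finrank_rowSpace_vanishing_add G B, Nat.add_sub_cancel_left]
  have h := Module.natCard_eq_pow_finrank (K := ZMod 2) (V := LinearMap.ker
    ((LinearMap.funLeft (ZMod 2) (ZMod 2) (Subtype.val : B → ι)).domRestrict
      (Submodule.span (ZMod 2) (Set.range G))))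
  rw [Nat.card_zmod] at h
  refine Eq.trans ?_ h
  refine Eq.trans ?_ (Nat.card_congr (Equiv.subtypeSubtypeEquivSubtypeInter
    (· ∈ Submodule.span (ZMod 2) (Set.range G))
    (fun u => LinearMap.funLeft (ZMod 2) (ZMod 2) (Subtype.val : B → ι) u = 0))).symm
  refine (Nat.subtype_card _ fun u => ?_).symm
  simp [hFlow, funext_iff, LinearMap.funLeft_apply]

theorem sum_prod_coset {ι : Type*} [Fintype ι] [DecidableEq ι] (ω y : ℂ)
    (hy : ω * y = (1 - ω) ^ 2) (u v : ι → ZMod 2) :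
    ∑ f : ι → ZMod 2,
      ω ^ ((Finset.univ.filter (fun e => (u + f) e ≠ 0)).card
        + (Finset.univ.filter (fun e => f e ≠ 0)).card
        + (Finset.univ.filter (fun e => (f - v) e ≠ 0)).card) =
      ω ^ Fintype.card ι * (1 + ω) ^ Fintype.card ι *
        ∏ e, (1 + if u e = 0 ∧ v e = 0 then y else 0) := by
  have edge : ∀ a b : ZMod 2, ∑ c : ZMod 2, ω ^ ((if a + c ≠ 0 then 1 else 0) +
      (if c ≠ 0 then 1 else 0) + (if c - b ≠ 0 then 1 else 0)) =
      ω * (1 + ω) * (1 + if a = 0 ∧ b = 0 then y else 0) := by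
    intro a b
    have h11 : (1 : ZMod 2) + 1 = 0 := by decide
    have hsum : ∀ g : ZMod 2 → ℂ, ∑ c : ZMod 2, g c = g 0 + g 1 := fun g => Fin.sum_univ_two g
    have hab : ∀ c : ZMod 2, c = 0 ∨ c = 1 := by decide
    rw [hsum]
    rcases hab a with rfl | rfl <;> rcases hab b with rfl | rfl <;>
      simp [h11] <;> first | ring1 | linear_combination (-(1 + ω)) * hy
  calc _ = ∑ f : ι → ZMod 2, ∏ e, ω ^ ((if u e + f e ≠ 0 then 1 else 0) +
      (if f e ≠ 0 then 1 else 0) + (if f e - v e ≠ 0 then 1 else 0)) := by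
        refine Finset.sum_congr rfl fun f _ => ?_
        rw [Finset.prod_pow_eq_pow_sum, Finset.sum_add_distrib, Finset.sum_add_distrib,
          Finset.card_filter, Finset.card_filter, Finset.card_filter]
        rfl
    _ = ∏ e, ∑ c : ZMod 2, ω ^ ((if u e + c ≠ 0 then 1 else 0) +
      (if c ≠ 0 then 1 else 0) + (if c - v e ≠ 0 then 1 else 0)) := by
        rw [Finset.prod_univ_sum, Fintype.piFinset_univ]
    _ = _ := by
        simp_rw [edge, Finset.prod_mul_distrib, Finset.prod_const, Finset.card_univ]

/-- **Theorem 5.2.** Parcels of triples over GF(2) defined by sums of sizes of supports. -/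
theorem stmt_14
    {ι : Type*} [Fintype ι] [DecidableEq ι]
    {n : ℕ} (G : Fin n → ι → ZMod 2)
    (rk : Finset ι → ℕ)
    (hrk : ∀ B : Finset ι,
      rk B = Module.finrank (ZMod 2)
        (Submodule.span (ZMod 2) ((fun e => fun i => G i e) '' (B : Set ι))))
    (r : ℕ) (hr : r = rk Finset.univ)
    (Flow : (ι → ZMod 2) → Prop) [DecidablePred Flow]
    (hFlow : ∀ h : ι → ZMod 2, Flow h ↔ h ∈ Submodule.span (ZMod 2) (Set.range G))
    (σ : ℕ) (hσ : 2 < σ)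
    (ρ : ℤ) (hρ : Int.gcd ρ (σ : ℤ) = 1)
    (θ : ℝ) (hθ : θ = 2 * (ρ : ℝ) * Real.pi / (σ : ℝ))
    (ω : ℂ) (hω : ω = Complex.exp (θ * Complex.I)) :
    ∑ k ∈ Finset.range σ, ω ^ k *
        ((Finset.univ.filter (fun t : (ι → ZMod 2) × (ι → ZMod 2) × (ι → ZMod 2) =>
          Flow (t.1 - t.2.1) ∧ Flow (t.2.1 - t.2.2) ∧
            ((Finset.univ.filter (fun e => t.1 e ≠ 0)).card
              + (Finset.univ.filter (fun e => t.2.1 e ≠ 0)).card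
              + (Finset.univ.filter (fun e => t.2.2 e ≠ 0)).card) % σ = k)).card : ℂ)
      = ω ^ (Fintype.card ι - r) * (1 + ω) ^ (Fintype.card ι) * (1 - ω) ^ (2 * r) *
          ∑ B : Finset ι,
            (2 / ((Real.cos θ : ℂ) - 1)) ^ (r - rk B) *
              (2 * ((Real.cos θ : ℂ) - 1)) ^ (B.card - rk B) := by
  have hσ0 : (σ : ℂ) ≠ 0 := by exact_mod_cast (by omega : σ ≠ 0)
  have hωσ : ω ^ σ = 1 := by
    rw [hω, ← Complex.exp_nat_mul, Complex.exp_eq_one_iff]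
    refine ⟨ρ, ?_⟩
    rw [hθ]
    push_cast
    field_simp
  have hω1 : ω ≠ 1 := by
    rw [hω, Ne, Complex.exp_eq_one_iff]
    rintro ⟨m, hm⟩
    have h1 : (ρ : ℂ) = m * σ := by
      rw [hθ] at hm
      push_cast at hm
      have := Complex.two_pi_I_ne_zero
      field_simp at hm
      linear_combination hm
    have h2 : ρ = m * σ := by exact_mod_cast h1
    rw [h2, Int.gcd_mul_left_left] at hρ
    simp at hρ
    omega
  set y : ℂ := 2 * ((Real.cos θ : ℂ) - 1) with hydef
  have hy : ω * y = (1 - ω) ^ 2 := by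
    have h1 : Complex.exp (θ * Complex.I) * Complex.exp (-θ * Complex.I) = 1 := by
      rw [← Complex.exp_add]; simp
    rw [hydef, Complex.ofReal_cos, Complex.cos, ← hω] at *
    linear_combination h1
  have hy0 : y ≠ 0 := by
    rintro h
    rw [h, mul_zero] at hy
    exact hω1 (sub_eq_zero.mp (pow_eq_zero_iff two_ne_zero |>.mp hy.symm)).symm
  have hrF : r = Module.finrank (ZMod 2) (Submodule.span (ZMod 2) (Set.range G)) := by
    rw [hr, hrk, finrank_column_span_univ]
  have hrkr : ∀ B, rk B ≤ r := fun B => by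
    rw [hrF, hrk, ← finrank_rowSpace_vanishing_add G B]
    exact Nat.le_add_right _ _
  have hrkc : ∀ B, rk B ≤ B.card := fun B => by
    rw [hrk, ← Finset.coe_image]
    exact (finrank_span_finset_le_card _).trans Finset.card_image_le
  have hrE : r ≤ Fintype.card ι := hr ▸ hrkc _
  set N : (ι → ZMod 2) × (ι → ZMod 2) × (ι → ZMod 2) → ℕ := fun t =>
    (Finset.univ.filter (fun e => t.1 e ≠ 0)).card
      + (Finset.univ.filter (fun e => t.2.1 e ≠ 0)).card
      + (Finset.univ.filter (fun e => t.2.2 e ≠ 0)).card with hN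
  calc _ = ∑ t : (ι → ZMod 2) × (ι → ZMod 2) × (ι → ZMod 2),
        if Flow (t.1 - t.2.1) ∧ Flow (t.2.1 - t.2.2) then ω ^ N t else 0 := by
        have hcard : ∀ k, ((Finset.univ.filter fun t => Flow (t.1 - t.2.1) ∧
            Flow (t.2.1 - t.2.2) ∧ N t % σ = k).card : ℂ) =
            ∑ t, if Flow (t.1 - t.2.1) ∧ Flow (t.2.1 - t.2.2) ∧ N t % σ = k then 1 else 0 :=
          fun k => by rw [Finset.card_filter]; push_cast; rfl
        refine (Finset.sum_congr rfl fun k _ => congrArg (ω ^ k * ·) (hcard k)).trans ?_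
        simp_rw [Finset.mul_sum]
        rw [Finset.sum_comm]
        refine Finset.sum_congr rfl fun t _ => ?_
        by_cases h : Flow (t.1 - t.2.1) ∧ Flow (t.2.1 - t.2.2)
        · simp only [h, true_and, if_true]
          rw [Finset.sum_eq_single (N t % σ)]
          · rw [if_pos rfl, mul_one, ← pow_eq_pow_mod _ hωσ]
          · intro k _ hk
            rw [if_neg (fun h' => hk h'.symm)]
            simp
          · intro h'
            exact absurd (Finset.mem_range.mpr (Nat.mod_lt _ (by omega))) h'
        · rw [if_neg h]
          refine Finset.sum_eq_zero fun k _ => ?_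
          rw [if_neg fun h' => h ⟨h'.1, h'.2.1⟩]
          simp
    _ = ∑ u : ι → ZMod 2, ∑ v : ι → ZMod 2, if Flow u ∧ Flow v then
          ∑ f : ι → ZMod 2, ω ^ N (u + f, f, f - v) else 0 := by
        simp_rw [Fintype.sum_prod_type]
        rw [Finset.sum_comm]
        have h1 : ∀ f : ι → ZMod 2, (∑ a : ι → ZMod 2, ∑ b : ι → ZMod 2,
            if Flow (a - f) ∧ Flow (f - b) then ω ^ N (a, f, b) else 0) =
            ∑ u : ι → ZMod 2, ∑ v : ι → ZMod 2,
              if Flow u ∧ Flow v then ω ^ N (u + f, f, f - v) else 0 := fun f => by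
          rw [← Equiv.sum_comp (Equiv.addRight f)]
          refine Finset.sum_congr rfl fun u _ => ?_
          rw [← Equiv.sum_comp (Equiv.subLeft f)]
          refine Finset.sum_congr rfl fun v _ => ?_
          simp
        simp_rw [h1]
        rw [Finset.sum_comm]
        refine Finset.sum_congr rfl fun u _ => ?_
        rw [Finset.sum_comm]
        refine Finset.sum_congr rfl fun v _ => ?_
        split_ifs <;> simp
    _ = ω ^ Fintype.card ι * (1 + ω) ^ Fintype.card ι * ∑ B : Finset ι,
          ((Finset.univ.filter (fun u : ι → ZMod 2 => Flow u ∧ ∀ e ∈ B, u e = 0)).card : ℂ) ^ 2 *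
            y ^ B.card := by
        have hterm : ∀ u v : ι → ZMod 2, (if Flow u ∧ Flow v then
            ∑ f : ι → ZMod 2, ω ^ N (u + f, f, f - v) else 0) =
            ω ^ Fintype.card ι * (1 + ω) ^ Fintype.card ι * ∑ B : Finset ι,
              (if Flow u ∧ ∀ e ∈ B, u e = 0 then 1 else 0) *
                (if Flow v ∧ ∀ e ∈ B, v e = 0 then 1 else 0) * y ^ B.card := fun u v => by
          by_cases h : Flow u ∧ Flow v
          · rw [if_pos h, sum_prod_coset ω y hy, Finset.prod_one_add, Finset.powerset_univ]
            congr 1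
            refine Finset.sum_congr rfl fun B _ => ?_
            rw [Finset.prod_ite_zero, Finset.prod_const]
            simp only [h, true_and, forall_and]
            split_ifs <;> simp_all
          · rw [if_neg h, Finset.sum_eq_zero, mul_zero]
            intro B _
            rcases not_and_or.mp h with h | h <;> simp [h]
        simp_rw [hterm, ← Finset.mul_sum]
        congr 1
        calc _ = ∑ B : Finset ι, ∑ u : ι → ZMod 2, ∑ v : ι → ZMod 2,
              (if Flow u ∧ ∀ e ∈ B, u e = 0 then 1 else 0) *
                (if Flow v ∧ ∀ e ∈ B, v e = 0 then 1 else 0) * y ^ B.card := by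
              simp_rw [Finset.sum_comm (t := (Finset.univ : Finset (Finset ι)))]
          _ = _ := by
              refine Finset.sum_congr rfl fun B _ => ?_
              simp_rw [← Finset.sum_mul, ← Finset.mul_sum, ← Finset.sum_mul]
              rw [sq, Finset.card_filter]
              push_cast
              rfl
    _ = _ := by
        rw [mul_right_comm _ _ ((1 - ω) ^ (2 * r)), mul_right_comm _ _ (∑ B : Finset ι, _),
          mul_right_comm _ ((1 + ω) ^ _)]
        congr 1
        rw [Finset.mul_sum, Finset.mul_sum]
        refine Finset.sum_congr rfl fun B _ => ?_
        rw [card_rowSpace_vanishing G Flow hFlow, ← hrk, ← hrF, pow_mul, ← hy]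
        obtain ⟨a, ha⟩ := Nat.exists_eq_add_of_le (hrkr B)
        obtain ⟨b, hb⟩ := Nat.exists_eq_add_of_le (hrkc B)
        obtain ⟨c, hc⟩ := Nat.exists_eq_add_of_le hrE
        have h4 : 2 / ((Real.cos θ : ℂ) - 1) = 4 / y := by
          rw [hydef, ← mul_div_mul_left _ _ (two_ne_zero' ℂ)]; norm_num
        rw [h4, hc, hb, Nat.add_sub_cancel_left, Nat.add_sub_cancel_left, ha,
          Nat.add_sub_cancel_left]
        have h2 : (4 : ℂ) ^ a = (2 ^ a) ^ 2 := by rw [← pow_mul, mul_comm, pow_mul]; norm_num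
        rw [div_pow, h2]
        push_cast
        clear_value y
        field_simp
        ring
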